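/- arXiv:1702.07041 — 2 statements merged into one kernel-verified Lean document; each statement's English description precedes it below -/
import Mathlib

section
/- Let κ be a regular uncountable cardinal. Then Sp(κ)(unbounded) holds if and only if κ is not weakly compact. -/
open Cardinal Set

/-- A `κ`-list: a sequence `⟨d_α : α < κ⟩` with `d_α ⊆ α`. -/
def IsKappaList (κo : Ordinal) (d : Ordinal → Set Ordinal) : Prop :=
  ∀ α < κo, d α ⊆ Set.Iio α

/-- `A` is an unbounded subset of `κ`. -/
def UnbddIn (κo : Ordinal) (A : Set Ordinal) : Prop :=
  A ⊆ Set.Iio κo ∧ ∀ γ < κo, ∃ α ∈ A, γ ≤ α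

/-- `Sp(κ)(unbounded)`: there is a `κ`-list splitting every unbounded subset of `κ`
into unbounded sets. -/
def SpUnbdd (κ : Cardinal) : Prop :=
  ∃ d : Ordinal → Set Ordinal, IsKappaList κ.ord d ∧
    ∀ A : Set Ordinal, UnbddIn κ.ord A →
      ∃ β < κ.ord, UnbddIn κ.ord {α | α ∈ A ∧ β ∈ d α} ∧
        UnbddIn κ.ord {α | α ∈ A ∧ β < α ∧ β ∉ d α}

/-- `κ` is weakly compact: `κ` is inaccessible and has the tree property, i.e. every
downward-closed subtree of `2^{<κ}` (nodes of length `γ` coded as subsets of `γ`)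
of height `κ` with all levels of size `< κ` has a cofinal branch. -/
def WeaklyCompact (κ : Cardinal) : Prop :=
  κ.IsInaccessible ∧
    ∀ T : Set (Ordinal × Set Ordinal),
      (∀ p ∈ T, p.1 < κ.ord ∧ p.2 ⊆ Set.Iio p.1) →
      (∀ p ∈ T, ∀ γ ≤ p.1, (γ, p.2 ∩ Set.Iio γ) ∈ T) →
      (∀ γ < κ.ord, ∃ s : Set Ordinal, (γ, s) ∈ T) →
      (∀ γ < κ.ord, Cardinal.mk ↥{s : Set Ordinal | (γ, s) ∈ T} < Cardinal.lift.{1,0} κ) →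
      ∃ b : Set Ordinal, ∀ γ < κ.ord, (γ, b ∩ Set.Iio γ) ∈ T

theorem exists_strict_bound_of_isRegular {κ : Cardinal} (hreg : κ.IsRegular) {γ : Ordinal}
    (hγ : γ < κ.ord) (f : Ordinal → Ordinal) (hf : ∀ β < γ, f β < κ.ord) :
    ∃ δ < κ.ord, ∀ β < γ, f β < δ := by
  refine ⟨⨆ i : γ.ToType, f i.toOrd + 1, ?_, fun β hβ ↦ ?_⟩
  · refine Ordinal.iSup_add_one_lt_of_lt_cof (f := fun i : γ.ToType ↦ f i.toOrd) ?_
      fun i ↦ hf _ i.toOrd.2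
    rw [hreg.cof_ord, Cardinal.mk_toType]
    exact Cardinal.lt_ord.1 hγ
  · have h := Ordinal.le_iSup (fun i : γ.ToType ↦ f i.toOrd + 1)
      (Ordinal.ToType.mk ⟨β, hβ⟩)
    simp only [OrderIso.symm_apply_apply] at h
    exact (Order.lt_succ _).trans_le h

theorem UnbddIn.exists_lt_of_not_unbddIn {κo : Ordinal} {A B : Set Ordinal} (hA : UnbddIn κo A)
    (hB : B ⊆ A) (h : ¬ UnbddIn κo B) : ∃ δ < κo, ∀ α ∈ B, α < δ := by
  by_contra! hcon
  exact h ⟨hB.trans hA.1, hcon⟩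

/-- If no `β < κ` splits the unbounded set `A`, then the sets `d α` for `α ∈ A` converge to
a single set, on every proper initial segment of `κ`. -/
theorem exists_eventually_inter_Iio_eq {κ : Cardinal} (hreg : κ.IsRegular)
    {d : Ordinal → Set Ordinal} {A : Set Ordinal} (hA : UnbddIn κ.ord A)
    (hsplit : ∀ β < κ.ord, UnbddIn κ.ord {α | α ∈ A ∧ β ∈ d α} →
      ¬ UnbddIn κ.ord {α | α ∈ A ∧ β < α ∧ β ∉ d α}) :
    ∃ b : Set Ordinal, ∀ γ < κ.ord, ∃ δ < κ.ord, ∀ α ∈ A, δ ≤ α →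
      d α ∩ Iio γ = b ∩ Iio γ := by
  have hpoint : ∀ β, ∃ δ, β < κ.ord → δ < κ.ord ∧ ∀ α ∈ A, δ ≤ α →
      (β ∈ d α ↔ UnbddIn κ.ord {α | α ∈ A ∧ β ∈ d α}) := by
    intro β
    by_cases hβ : β < κ.ord
    swap
    · exact ⟨0, fun h ↦ absurd h hβ⟩
    by_cases hb : UnbddIn κ.ord {α | α ∈ A ∧ β ∈ d α}
    · obtain ⟨δ, hδ, h⟩ := hA.exists_lt_of_not_unbddIn (fun _ h ↦ h.1) (hsplit β hβ hb)
      refine ⟨max δ (Order.succ β), fun _ ↦ ⟨max_lt hδ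
        ((isSuccLimit_ord hreg.aleph0_le).succ_lt hβ), fun α hα hle ↦ iff_of_true ?_ hb⟩⟩
      by_contra hn
      exact (h α ⟨hα, Order.succ_le_iff.1 ((le_max_right _ _).trans hle), hn⟩).not_ge
        ((le_max_left _ _).trans hle)
    · obtain ⟨δ, hδ, h⟩ := hA.exists_lt_of_not_unbddIn (fun _ h ↦ h.1) hb
      exact ⟨δ, fun _ ↦ ⟨hδ, fun α hα hle ↦
        iff_of_false (fun hm ↦ (h α ⟨hα, hm⟩).not_ge hle) hb⟩⟩
  choose f hf using hpoint
  refine ⟨{β | UnbddIn κ.ord {α | α ∈ A ∧ β ∈ d α}}, fun γ hγ ↦ ?_⟩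
  obtain ⟨δ, hδ, h⟩ := exists_strict_bound_of_isRegular hreg hγ f
    fun β hβ ↦ (hf β (hβ.trans hγ)).1
  refine ⟨δ, hδ, fun α hα hle ↦ ?_⟩
  ext β
  simp only [mem_inter_iff, mem_Iio, mem_ofPred_eq, and_congr_left_iff]
  exact fun hβ ↦ (hf β (hβ.trans hγ)).2 α hα ((h β hβ).le.trans hle)

theorem spUnbdd_of_not_isStrongPrelimit {κ : Cardinal} (hreg : κ.IsRegular)
    (h : ¬ κ.IsStrongPrelimit) : SpUnbdd κ := by
  obtain ⟨x, hx, hle⟩ : ∃ x < κ, κ ≤ 2 ^ x := by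
    simpa [Cardinal.IsStrongPrelimit] using h
  have hmk : #(Iio κ.ord) ≤ #(𝒫 (Iio x.ord)) := by
    rw [Cardinal.mk_powerset, Cardinal.mk_Iio_ordinal, Cardinal.mk_Iio_ordinal,
      Cardinal.card_ord, Cardinal.card_ord, ← Cardinal.lift_two_power]
    exact Cardinal.lift_le.2 hle
  obtain ⟨e⟩ := hmk
  let d : Ordinal → Set Ordinal := fun α ↦
    if h : x.ord ≤ α ∧ α < κ.ord then (e ⟨α, h.2⟩ : Set Ordinal) else ∅
  have hd : ∀ α, d α ⊆ Iio x.ord ∧ d α ⊆ Iio α := by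
    intro α
    by_cases hα : x.ord ≤ α ∧ α < κ.ord
    · have hsub : d α ⊆ Iio x.ord := by
        simp only [d, dif_pos hα]
        exact (e ⟨α, hα.2⟩).2
      exact ⟨hsub, hsub.trans (Iio_subset_Iio hα.1)⟩
    · simp [d, dif_neg hα]
  have hxκ : x.ord < κ.ord := Cardinal.ord_lt_ord.2 hx
  refine ⟨d, fun α _ ↦ (hd α).2, fun A hA ↦ ?_⟩
  by_contra! hsplit
  obtain ⟨b, hb⟩ := exists_eventually_inter_Iio_eq hreg hA hsplit
  obtain ⟨δ, hδ, hδb⟩ := hb _ hxκ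
  obtain ⟨α, hα, hαle⟩ := hA.2 (max δ x.ord) (max_lt hδ hxκ)
  obtain ⟨α', hα', hlt⟩ := hA.2 (Order.succ α)
    ((isSuccLimit_ord hreg.aleph0_le).succ_lt (hA.1 hα))
  rw [Order.succ_le_iff] at hlt
  have hδα := (le_max_left _ _).trans hαle
  have hxα := (le_max_right _ _).trans hαle
  have heq : d α = d α' := by
    rw [← inter_eq_left.2 (hd α).1, ← inter_eq_left.2 (hd α').1, hδb α hα hδα,
      hδb α' hα' (hδα.trans hlt.le)]
  have hcα : x.ord ≤ α ∧ α < κ.ord := ⟨hxα, hA.1 hα⟩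
  have hcα' : x.ord ≤ α' ∧ α' < κ.ord := ⟨hxα.trans hlt.le, hA.1 hα'⟩
  simp only [d, dif_pos hcα, dif_pos hcα'] at heq
  have := congrArg Subtype.val (e.injective (Subtype.ext heq))
  exact hlt.ne this

theorem spUnbdd_of_tree_without_branch {κ : Cardinal} (hreg : κ.IsRegular)
    {T : Set (Ordinal × Set Ordinal)}
    (hT : ∀ p ∈ T, p.1 < κ.ord ∧ p.2 ⊆ Iio p.1)
    (hclosed : ∀ p ∈ T, ∀ γ ≤ p.1, (γ, p.2 ∩ Iio γ) ∈ T)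
    (hheight : ∀ γ < κ.ord, ∃ s : Set Ordinal, (γ, s) ∈ T)
    (hbranch : ¬ ∃ b : Set Ordinal, ∀ γ < κ.ord, (γ, b ∩ Iio γ) ∈ T) : SpUnbdd κ := by
  have hlevel : ∀ γ, ∃ s : Set Ordinal, γ < κ.ord → (γ, s) ∈ T := by
    intro γ
    by_cases hγ : γ < κ.ord
    · exact (hheight γ hγ).imp fun s hs _ ↦ hs
    · exact ⟨∅, fun h ↦ absurd h hγ⟩
  choose d hd using hlevel
  refine ⟨d, fun α hα ↦ (hT _ (hd α hα)).2, fun A hA ↦ ?_⟩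
  by_contra! hsplit
  obtain ⟨b, hb⟩ := exists_eventually_inter_Iio_eq hreg hA hsplit
  refine hbranch ⟨b, fun γ hγ ↦ ?_⟩
  obtain ⟨δ, hδ, hδb⟩ := hb γ hγ
  obtain ⟨α, hα, hle⟩ := hA.2 (max δ γ) (max_lt hδ hγ)
  rw [← hδb α hα ((le_max_left _ _).trans hle)]
  exact hclosed _ (hd α (hA.1 hα)) γ ((le_max_right _ _).trans hle)

theorem WeaklyCompact.exists_branch_of_isKappaList {κ : Cardinal} (h : WeaklyCompact κ)
    {d : Ordinal → Set Ordinal} (hd : IsKappaList κ.ord d) :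
    ∃ b : Set Ordinal, ∀ γ < κ.ord, ∃ α < κ.ord, γ ≤ α ∧ d α ∩ Iio γ = b ∩ Iio γ := by
  obtain ⟨hinacc, htree⟩ := h
  obtain ⟨b, hb⟩ := htree {p | ∃ α < κ.ord, p.1 ≤ α ∧ d α ∩ Iio p.1 = p.2}
    (by
      rintro ⟨γ, s⟩ ⟨α, hα, hle, hs⟩
      obtain rfl : d α ∩ Iio γ = s := hs
      exact ⟨hle.trans_lt hα, inter_subset_right⟩)
    (by
      rintro ⟨γ, s⟩ ⟨α, hα, hle, hs⟩ γ' hγ'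
      obtain rfl : d α ∩ Iio γ = s := hs
      refine ⟨α, hα, hγ'.trans hle, ?_⟩
      rw [inter_assoc, inter_eq_right.2 (Iio_subset_Iio hγ')])
    (fun γ hγ ↦ ⟨d γ, γ, hγ, le_rfl, inter_eq_left.2 (hd γ hγ)⟩)
    (by
      intro γ hγ
      refine (Cardinal.mk_le_mk_of_subset (t := 𝒫 (Iio γ)) ?_).trans_lt ?_
      · rintro s ⟨α, -, -, hs⟩
        obtain rfl : d α ∩ Iio γ = s := hs
        exact inter_subset_right
      · rw [Cardinal.mk_powerset, Cardinal.mk_Iio_ordinal, ← Cardinal.lift_two_power]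
        exact Cardinal.lift_lt.2 (hinacc.isStrongPrelimit (Cardinal.lt_ord.1 hγ)))
  exact ⟨b, hb⟩

theorem WeaklyCompact.not_spUnbdd {κ : Cardinal} (h : WeaklyCompact κ) : ¬ SpUnbdd κ := by
  rintro ⟨d, hd, hsplit⟩
  have hreg := h.1.isRegular
  obtain ⟨b, hb⟩ := h.exists_branch_of_isKappaList hd
  choose! f hfκ hle hfb using hb
  obtain ⟨β, hβ, hpos, hneg⟩ := hsplit (f '' Iio κ.ord)
    ⟨by rintro _ ⟨γ, hγ, rfl⟩; exact hfκ γ hγ,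
      fun γ hγ ↦ ⟨f γ, mem_image_of_mem f hγ, hle γ hγ⟩⟩
  have hsucc := (isSuccLimit_ord hreg.aleph0_le).succ_lt hβ
  obtain ⟨δ, hδ, hfδ⟩ := exists_strict_bound_of_isRegular hreg hsucc f
    fun γ hγ ↦ hfκ γ (hγ.trans hsucc)
  have hmem : ∀ γ < κ.ord, δ ≤ f γ → (β ∈ d (f γ) ↔ β ∈ b) := by
    intro γ hγ hδγ
    have hβγ : β < γ := by
      by_contra! hcon
      exact (hfδ γ (Order.lt_succ_iff.2 hcon)).not_ge hδγ
    simpa [hβγ] using Set.ext_iff.1 (hfb γ hγ) β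
  obtain ⟨_, ⟨⟨γ, hγ, rfl⟩, hin⟩, hδγ⟩ := hpos.2 δ hδ
  obtain ⟨_, ⟨⟨γ', hγ', rfl⟩, -, hout⟩, hδγ'⟩ := hneg.2 δ hδ
  exact hout ((hmem γ' hγ' hδγ').2 ((hmem γ hγ hδγ).1 hin))

/-- For a regular uncountable cardinal `κ`, `Sp(κ)(unbounded)` holds iff `κ` is not
weakly compact. -/
theorem sp_unbounded_iff_not_weaklyCompact (κ : Cardinal) (hκ : ℵ₀ < κ)
    (hreg : κ.IsRegular) :
    SpUnbdd κ ↔ ¬ WeaklyCompact κ := by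
  refine ⟨fun h hwc ↦ hwc.not_spUnbdd h, fun hnot ↦ ?_⟩
  by_cases hlim : κ.IsStrongPrelimit
  · by_contra hsp
    refine hnot ⟨⟨hκ, hreg.le_cof_ord, hlim⟩, fun T hT hclosed hheight _ ↦ ?_⟩
    by_contra hbranch
    exact hsp (spUnbdd_of_tree_without_branch hreg hT hclosed hheight hbranch)
  · exact spUnbdd_of_not_isStrongPrelimit hreg hlim
end

section
/- Let κ be a regular uncountable cardinal, λ ≥ κ a cardinal, and d a P_κλ-list. Then d splits every unbounded subset of P_κλ into unbounded sets if and only if d does not have a strong branch. -/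
open Cardinal Set

/-- `P_κλ`: the collection of subsets of `λ` of size less than `κ`. -/
def Pkl (κ lam : Cardinal) : Set (Set Ordinal) :=
  {x | x ⊆ Set.Iio lam.ord ∧ Cardinal.mk ↥x < Cardinal.lift.{1,0} κ}

/-- `U` is an unbounded (cofinal) subset of `P_κλ`. -/
def PklUnbdd (κ lam : Cardinal) (U : Set (Set Ordinal)) : Prop :=
  U ⊆ Pkl κ lam ∧ ∀ x ∈ Pkl κ lam, ∃ y ∈ U, x ⊆ y

/-- `B` is a strong branch of the `P_κλ`-list `d`: there is an unbounded `U ⊆ P_κλ` such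
that for every `x ∈ P_κλ` there is `y ⊇ x` such that `d_z ∩ x = B ∩ x` for all `z ∈ U`
with `z ⊇ y`. -/
def PklStrongBranch (κ lam : Cardinal) (d : Set Ordinal → Set Ordinal)
    (B : Set Ordinal) : Prop :=
  B ⊆ Set.Iio lam.ord ∧ ∃ U, PklUnbdd κ lam U ∧
    ∀ x ∈ Pkl κ lam, ∃ y ∈ Pkl κ lam, x ⊆ y ∧
      ∀ z ∈ U, y ⊆ z → d z ∩ x = B ∩ x

theorem Cardinal.IsRegular.lift_isRegular {κ : Cardinal} (h : κ.IsRegular) :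
    (Cardinal.lift.{1, 0} κ).IsRegular := by
  refine ⟨Cardinal.aleph0_le_lift.2 h.aleph0_le, ?_⟩
  rw [← Cardinal.lift_ord, ← Ordinal.lift_cof, Cardinal.lift_le]
  exact h.2

theorem singleton_mem_Pkl {κ lam : Cardinal} (hκ : ℵ₀ < κ) {β : Ordinal} (hβ : β < lam.ord) :
    {β} ∈ Pkl κ lam := by
  refine ⟨by simpa using hβ, ?_⟩
  rw [Cardinal.mk_singleton]
  exact Cardinal.one_lt_aleph0.trans (Cardinal.aleph0_lt_lift.2 hκ)

theorem union_mem_Pkl {κ lam : Cardinal} (hreg : κ.IsRegular) {x y : Set Ordinal}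
    (hx : x ∈ Pkl κ lam) (hy : y ∈ Pkl κ lam) : x ∪ y ∈ Pkl κ lam :=
  ⟨union_subset hx.1 hy.1, (Cardinal.mk_union_le x y).trans_lt
    (Cardinal.add_lt_of_lt hreg.lift_isRegular.aleph0_le hx.2 hy.2)⟩

theorem biUnion_mem_Pkl {κ lam : Cardinal} (hreg : κ.IsRegular) {x : Set Ordinal}
    (hx : x ∈ Pkl κ lam) {t : Ordinal → Set Ordinal} (ht : ∀ β ∈ x, t β ∈ Pkl κ lam) :
    ⋃ β ∈ x, t β ∈ Pkl κ lam :=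
  ⟨iUnion₂_subset fun β hβ => (ht β hβ).1,
    (Cardinal.card_biUnion_lt_iff_forall_of_isRegular hreg.lift_isRegular hx.2).2
      fun β hβ => (ht β hβ).2⟩

theorem exists_bound_of_not_PklUnbdd {κ lam : Cardinal} {U : Set (Set Ordinal)}
    (hU : U ⊆ Pkl κ lam) (h : ¬ PklUnbdd κ lam U) : ∃ y ∈ Pkl κ lam, ∀ z ∈ U, ¬ y ⊆ z := by
  by_contra! hc
  exact h ⟨hU, hc⟩

/-- A `P_κλ`-list `d` splits every unbounded subset of `P_κλ` into unbounded sets iff `d`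
has no strong branch. -/
theorem pkl_splits_unbounded_iff_no_strong_branch (κ lam : Cardinal) (hκ : ℵ₀ < κ)
    (hreg : κ.IsRegular) (hkl : κ ≤ lam)
    (d : Set Ordinal → Set Ordinal) (hd : ∀ x ∈ Pkl κ lam, d x ⊆ x) :
    (∀ A, PklUnbdd κ lam A → ∃ β < lam.ord,
        PklUnbdd κ lam {x | x ∈ A ∧ β ∈ d x} ∧
        PklUnbdd κ lam {x | x ∈ A ∧ β ∈ x ∧ β ∉ d x}) ↔
      ¬ ∃ B : Set Ordinal, PklStrongBranch κ lam d B := by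
  constructor
  · rintro hsplit ⟨B, -, U, hU, hbranch⟩
    obtain ⟨β, hβ, hpos, hneg⟩ := hsplit U hU
    obtain ⟨y, hy, -, hyz⟩ := hbranch {β} (singleton_mem_Pkl hκ hβ)
    obtain ⟨z, ⟨hzU, hz⟩, hyz₁⟩ := hpos.2 y hy
    obtain ⟨w, ⟨hwU, -, hw⟩, hyw⟩ := hneg.2 y hy
    have hB : β ∈ B := ((hyz z hzU hyz₁).subset ⟨hz, rfl⟩).1
    exact hw ((hyz w hwU hyw).symm.subset ⟨hB, rfl⟩).1
  · intro hno A hA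
    by_contra! hsplit
    have hbound : ∀ β, ∃ y, β < lam.ord → y ∈ Pkl κ lam ∧ ∀ z ∈ A, y ⊆ z → β ∈ z →
        (β ∈ d z ↔ PklUnbdd κ lam {x | x ∈ A ∧ β ∈ d x}) := by
      intro β
      by_cases hβ : β < lam.ord
      · by_cases hpos : PklUnbdd κ lam {x | x ∈ A ∧ β ∈ d x}
        · obtain ⟨y, hy, hyz⟩ := exists_bound_of_not_PklUnbdd
            (fun z hz => hA.1 hz.1) (hsplit β hβ hpos)
          exact ⟨y, fun _ => ⟨hy, fun z hz hsub hβz =>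
            iff_of_true (by_contra fun hn => hyz z ⟨hz, hβz, hn⟩ hsub) hpos⟩⟩
        · obtain ⟨y, hy, hyz⟩ := exists_bound_of_not_PklUnbdd
            (fun z hz => hA.1 hz.1) hpos
          exact ⟨y, fun _ => ⟨hy, fun z hz hsub _ =>
            iff_of_false (fun hn => hyz z ⟨hz, hn⟩ hsub) hpos⟩⟩
      · exact ⟨∅, fun h => absurd h hβ⟩
    choose t ht using hbound
    refine hno ⟨{β | β < lam.ord ∧ PklUnbdd κ lam {x | x ∈ A ∧ β ∈ d x}},
      fun β hβ => hβ.1, A, hA, fun x hx => ⟨x ∪ ⋃ β ∈ x, t β,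
        union_mem_Pkl hreg hx (biUnion_mem_Pkl hreg hx fun β hβ => (ht β (hx.1 hβ)).1),
        subset_union_left, fun z hz hsub => ?_⟩⟩
    ext β
    refine and_congr_left fun hβ => ?_
    have hlt : β < lam.ord := hx.1 hβ
    rw [(ht β hlt).2 z hz
      ((subset_biUnion_of_mem hβ).trans (subset_union_right.trans hsub))
      (hsub (Or.inl hβ))]
    exact (and_iff_right hlt).symm
end
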